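/- Let τ ∈ (0,1), ν ≥ −1/2, and let f ∈ E_{1,1,e} with sup_{t∈ℝ}|f(t)| < ∞. Then there exists a sequence of even polynomials P_n of degree at most 2⌊n/2⌋ (n ∈ ℕ) such that for every integer l ≥ 0, every r ∈ (0,∞], every α > −1, and every β > −1: lim_{n→∞} ‖f^{(l)} − P_n^{(l)}‖_{L_{r,μ_n}([−τn,τn])} = 0 and lim_{n→∞} ‖(Be_ν)^l(f) − (Be_ν)^l(P_n)‖_{L_{r,μ_n}([−τn,τn])} = 0, where μ_n(t) := |t|^α·(1−(t/(τn))²)^β. -/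

import Mathlib

open MeasureTheory Filter Topology Polynomial ENNReal

noncomputable section

/-- `f : ℂ → ℂ` is an entire function of exponential type `σ`. -/
def SphericalType1 (σ : ℝ) (f : ℂ → ℂ) : Prop :=
  Differentiable ℂ f ∧ ∀ ε : ℝ, 0 < ε → ∃ C : ℝ, ∀ z, ‖f z‖ ≤ C * Real.exp (σ * (1 + ε) * ‖z‖)

/-- The Bessel operator `Be_ν(φ)(r) = φ''(r) + (2ν+1)φ'(r)/r`, with the value at `0`
given by continuity (for even analytic `φ` this is `(2ν+2)φ''(0)`). -/
def besselOp (ν : ℝ) (f : ℂ → ℂ) : ℂ → ℂ := fun z =>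
  if z = 0 then (2*ν+2) * deriv (deriv f) 0
  else deriv (deriv f) z + (2*ν+1) * (deriv f z / z)

/-- The measure `|t|^α (1-(t/(τn))²)^β dt` on `[-τn, τn]`. -/
def wMeasN (τ α β : ℝ) (n : ℕ) : Measure ℝ :=
  (volume.restrict (Set.Icc (-(τ * n)) (τ * n))).withDensity
    fun t => ENNReal.ofReal (|t| ^ α * (1 - (t / (τ * n)) ^ 2) ^ β)


/-! ### Growth in the imaginary direction -/

lemma pl_aux (f : ℂ → ℂ) (hd : Differentiable ℂ f) (C M s : ℝ) (hs : 0 ≤ s)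
    (hC : ∀ z, ‖f z‖ ≤ C * Real.exp (s * ‖z‖)) (hM : ∀ t : ℝ, ‖f t‖ ≤ M) (z : ℂ) (hz : 0 ≤ z.im) :
    ‖f z‖ ≤ max C M * Real.exp (s * z.im) := by
  set g : ℂ → ℂ := fun z => f z * Complex.exp (Complex.I * s * z) with hg
  have hgn : ∀ z, ‖g z‖ = ‖f z‖ * Real.exp (-(s * z.im)) := by
    intro z
    simp [hg, Complex.norm_exp]
  have hgd : Differentiable ℂ g := by fun_prop
  have hgB : ∀ U : Set ℂ, ∃ c < (2 : ℝ), ∃ B,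
      g =O[Bornology.cobounded ℂ ⊓ 𝓟 U] fun z => Real.exp (B * ‖z‖ ^ c) := by
    intro U
    refine ⟨1, by norm_num, 2 * s, Asymptotics.IsBigO.of_bound C (Eventually.of_forall fun z => ?_)⟩
    rw [hgn, Real.rpow_one, Real.norm_of_nonneg (Real.exp_nonneg _)]
    have h1 : |z.im| ≤ ‖z‖ := Complex.abs_im_le_norm z
    have h2 : -(s * z.im) ≤ s * ‖z‖ := by
      have := mul_le_mul_of_nonneg_left (neg_le_of_abs_le h1) hs
      nlinarith
    calc ‖f z‖ * Real.exp (-(s * z.im)) ≤ (C * Real.exp (s * ‖z‖)) * Real.exp (s * ‖z‖) := by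
          apply mul_le_mul (hC z) (Real.exp_le_exp.2 h2) (Real.exp_nonneg _)
          exact (norm_nonneg _).trans (hC z)
      _ = C * Real.exp (2 * s * ‖z‖) := by
          rw [mul_assoc, ← Real.exp_add]; ring_nf
  have hre : ∀ x : ℝ, ‖g x‖ ≤ max C M := by
    intro x
    rw [hgn]; simpa using Or.inr (hM x)
  have him : ∀ x : ℝ, 0 ≤ x → ‖g (x * Complex.I)‖ ≤ max C M := by
    intro x hx
    rw [hgn]
    refine le_trans ?_ (le_max_left _ _)
    have := hC (x * Complex.I)
    calc _ ≤ (C * Real.exp (s * ‖(x * Complex.I : ℂ)‖)) * Real.exp (-(s * (x * Complex.I : ℂ).im)) := by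
          gcongr
      _ = C := by
        rw [mul_assoc, ← Real.exp_add]
        simp [abs_of_nonneg hx]
  have key : ‖g z‖ ≤ max C M := by
    rcases le_total 0 z.re with h | h
    · exact PhragmenLindelof.quadrant_I hgd.diffContOnCl (hgB _) (fun x _ => hre x) him h hz
    · exact PhragmenLindelof.quadrant_II hgd.diffContOnCl (hgB _) (fun x _ => hre x) him h hz
  rw [hgn, Real.exp_neg, ← div_eq_mul_inv, div_le_iff₀ (Real.exp_pos _)] at key
  exact key

lemma growth_im (f : ℂ → ℂ) (hf : SphericalType1 1 f) (hfe : ∀ z : ℂ, f (-z) = f z)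
    (hbd : BddAbove (Set.range fun t : ℝ => ‖f t‖)) (δ : ℝ) (hδ : 0 < δ) :
    ∃ K : ℝ, 0 ≤ K ∧ ∀ z, ‖f z‖ ≤ K * Real.exp ((1 + δ) * |z.im|) := by
  obtain ⟨C, hC⟩ := hf.2 δ hδ
  obtain ⟨M, hM⟩ := hbd
  have hM' : ∀ t : ℝ, ‖f t‖ ≤ M := fun t => hM ⟨t, rfl⟩
  refine ⟨max C M, le_max_of_le_right ((norm_nonneg _).trans (hM' 0)), fun z => ?_⟩
  have hC' : ∀ z, ‖f z‖ ≤ C * Real.exp ((1 + δ) * ‖z‖) := by simpa using hC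
  rcases le_total 0 z.im with h | h
  · rw [abs_of_nonneg h]
    exact pl_aux f hf.1 C M (1 + δ) (by linarith) hC' hM' z h
  · rw [abs_of_nonpos h, ← hfe]
    have := pl_aux f hf.1 C M (1 + δ) (by linarith) hC' hM' (-z) (by simpa using h)
    simpa using this

/-! ### Fourier / Chebyshev coefficients -/

local instance : Fact (0 < 2 * Real.pi) := ⟨Real.two_pi_pos⟩

/-- The function `θ ↦ f (a cos θ)` on the circle. -/
def circFun (f : ℂ → ℂ) (hf : Continuous f) (a : ℝ) : C(AddCircle (2 * Real.pi), ℂ) where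
  toFun x := f (a * ((fourier 1 x + fourier (-1) x) / 2))
  continuous_toFun := by fun_prop

lemma fourier_two_pi (k : ℤ) (θ : ℝ) :
    fourier k (θ : AddCircle (2 * Real.pi)) = Complex.exp (k * θ * Complex.I) := by
  rw [fourier_coe_apply]
  congr 1
  have : (Real.pi : ℂ) ≠ 0 := by exact_mod_cast Real.pi_ne_zero
  push_cast
  field_simp

lemma circFun_coe (f : ℂ → ℂ) (hf : Continuous f) (a θ : ℝ) :
    circFun f hf a (θ : AddCircle (2 * Real.pi)) = f (a * Complex.cos θ) := by
  simp only [circFun, ContinuousMap.coe_mk, fourier_two_pi]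
  congr 2
  rw [Complex.cos]
  simp

lemma coeff_circle (f : ℂ → ℂ) (hf : Continuous f) (a : ℝ) (k : ℤ) :
    fourierCoeff (circFun f hf a) k = (2 * Real.pi * Complex.I)⁻¹ *
      ∮ w in C(0, 1), w ^ (-k - 1) * f (a * ((w + w⁻¹) / 2)) := by
  rw [fourierCoeff_eq_intervalIntegral _ _ 0, circleIntegral]
  simp only [zero_add, deriv_circleMap, smul_eq_mul]
  have hI : ∀ θ : ℝ, circleMap 0 1 θ * Complex.I * ((circleMap 0 1 θ) ^ (-k - 1) *
      f (a * ((circleMap 0 1 θ + (circleMap 0 1 θ)⁻¹) / 2))) =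
      Complex.I * (fourier (-k) (θ : AddCircle (2 * Real.pi)) *
        circFun f hf a (θ : AddCircle (2 * Real.pi))) := by
    intro θ
    rw [circFun_coe, fourier_two_pi]
    have h1 : circleMap 0 1 θ = Complex.exp (θ * Complex.I) := by simp [circleMap]
    rw [h1, ← Complex.exp_neg, ← Complex.exp_int_mul]
    have h2 : (Complex.exp (θ * Complex.I) + Complex.exp (-(θ * Complex.I))) / 2 = Complex.cos θ := by
      rw [Complex.cos, neg_mul]
    rw [h2]
    have h3 : Complex.exp (((-k : ℤ) : ℂ) * θ * Complex.I) =
      Complex.exp (θ * Complex.I) * Complex.exp (((-k - 1 : ℤ) : ℂ) * (θ * Complex.I)) := by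
      rw [← Complex.exp_add]; congr 1; push_cast; ring
    rw [h3]; ring
  simp_rw [hI]
  rw [intervalIntegral.integral_const_mul]
  have : (Real.pi : ℂ) ≠ 0 := by exact_mod_cast Real.pi_ne_zero
  rw [Complex.real_smul]
  push_cast
  field_simp

lemma circle_shift (f : ℂ → ℂ) (hf : Differentiable ℂ f) (a : ℝ) (k : ℤ) (r R : ℝ) (hr : 0 < r)
    (hR : r ≤ R) :
    (∮ w in C(0, R), w ^ (-k - 1) * f (a * ((w + w⁻¹) / 2))) =
      ∮ w in C(0, r), w ^ (-k - 1) * f (a * ((w + w⁻¹) / 2)) := by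
  have hdiff : ∀ w : ℂ, w ≠ 0 →
      DifferentiableAt ℂ (fun w : ℂ => w ^ (-k - 1) * f (a * ((w + w⁻¹) / 2))) w := by
    intro w hw
    refine (differentiableAt_zpow.2 (Or.inl hw)).mul ?_
    refine (hf _).comp w ?_
    exact ((differentiableAt_id.add (differentiableAt_inv hw)).div_const 2).const_mul _
  refine Complex.circleIntegral_eq_of_differentiable_on_annulus_off_countable hr hR
    Set.countable_empty (fun w hw => ?_) (fun w hw => ?_)
  · refine (hdiff w ?_).continuousAt.continuousWithinAt
    rintro rfl
    exact hw.2 (by simpa using hr)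
  · refine hdiff w ?_
    rintro rfl
    exact hw.1.2 (by simpa using hr.le)

lemma coeff_bound (f : ℂ → ℂ) (hf : Differentiable ℂ f) (κ K : ℝ) (hκ : 0 ≤ κ) (hK : 0 ≤ K)
    (hb : ∀ z, ‖f z‖ ≤ K * Real.exp (κ * |z.im|)) (a s : ℝ) (ha : 0 ≤ a) (hs : 0 ≤ s) (k : ℤ) :
    ‖fourierCoeff (circFun f hf.continuous a) k‖ ≤
      K * Real.exp (κ * a * Real.sinh s) * Real.exp (-(|(k : ℝ)| * s)) := by
  have main : ∀ u : ℝ, |u| = s → ‖∮ w in C(0, Real.exp u), w ^ (-k - 1) * f (a * ((w + w⁻¹) / 2))‖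
      ≤ 2 * Real.pi * (K * Real.exp (κ * a * Real.sinh s) * Real.exp (-(k * u))) := by
    intro u hu
    refine (circleIntegral.norm_integral_le_of_norm_le_const
      (C := Real.exp ((-k - 1) * u) * (K * Real.exp (κ * a * Real.sinh s))) (Real.exp_nonneg _)
      fun w hw => ?_).trans (le_of_eq ?_)
    · have hw' : ‖w‖ = Real.exp u := by simpa using hw
      rw [norm_mul, norm_zpow, hw']
      have e1 : Real.exp u ^ (-k - 1) = Real.exp ((-k - 1) * u) := by
        rw [← Real.rpow_intCast, ← Real.exp_mul]; push_cast; ring_nf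
      rw [e1]
      refine mul_le_mul_of_nonneg_left ((hb _).trans ?_) (Real.exp_nonneg _)
      refine mul_le_mul_of_nonneg_left (Real.exp_le_exp.2 ?_) hK
      rw [mul_assoc]
      refine mul_le_mul_of_nonneg_left ?_ hκ
      have him : ((a : ℂ) * ((w + w⁻¹) / 2)).im = a * (w.im * (1 - Real.exp (-(2 * u))) / 2) := by
        rw [Complex.im_ofReal_mul]
        congr 1
        have : ((w + w⁻¹) / 2).im = (w + w⁻¹).im / 2 := by
          simp
        rw [this, Complex.add_im, Complex.inv_im, Complex.normSq_eq_norm_sq, hw', ← Real.exp_nat_mul,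
          Real.exp_neg]
        push_cast
        field_simp
        ring
      rw [him, abs_mul, abs_of_nonneg ha]
      refine mul_le_mul_of_nonneg_left ?_ ha
      rw [abs_div, abs_mul, abs_two]
      have hwim : |w.im| ≤ Real.exp u := hw' ▸ Complex.abs_im_le_norm w
      calc |w.im| * |1 - Real.exp (-(2 * u))| / 2 ≤ Real.exp u * |1 - Real.exp (-(2 * u))| / 2 := by
            gcongr
        _ = |Real.sinh u| := by
            have e2 : Real.exp u * |1 - Real.exp (-(2 * u))| = |Real.exp u - Real.exp (-u)| := by
              conv_lhs => rw [← abs_of_pos (Real.exp_pos u), ← abs_mul, mul_sub, mul_one,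
                ← Real.exp_add]
              ring_nf
            rw [Real.sinh_eq, abs_div, abs_two, e2]
        _ = Real.sinh s := by rw [← hu, Real.abs_sinh]
        _ ≤ Real.sinh s := le_rfl
    · have : Real.exp (-(k * u)) = Real.exp u * Real.exp ((-k - 1) * u) := by
        rw [← Real.exp_add]; ring_nf
      rw [this]; ring
  have key : ∃ u : ℝ, |u| = s ∧ (k : ℝ) * u = |(k : ℝ)| * s := by
    rcases le_total 0 (k : ℝ) with h | h
    · exact ⟨s, abs_of_nonneg hs, by rw [abs_of_nonneg h]⟩
    · exact ⟨-s, by rw [abs_neg, abs_of_nonneg hs], by rw [abs_of_nonpos h]; ring⟩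
  obtain ⟨u, hu, hku⟩ := key
  have hsh : (∮ w in C(0, 1), w ^ (-k - 1) * f (a * ((w + w⁻¹) / 2))) =
      ∮ w in C(0, Real.exp u), w ^ (-k - 1) * f (a * ((w + w⁻¹) / 2)) := by
    rcases le_total 0 u with h | h
    · exact (circle_shift f hf a k 1 _ one_pos (Real.one_le_exp h)).symm
    · exact circle_shift f hf a k _ 1 (Real.exp_pos u) (Real.exp_le_one_iff.2 h)
  rw [coeff_circle, hsh, norm_mul, ← hku]
  have h2 : ‖(2 * Real.pi * Complex.I : ℂ)⁻¹‖ = (2 * Real.pi)⁻¹ := by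
    simp [abs_of_pos Real.pi_pos]
  rw [h2, inv_mul_le_iff₀ Real.two_pi_pos]
  exact main u hu

/-! ### Chebyshev polynomials near `[-1,1]` -/

lemma norm_one_sub_cos (θ : ℂ) : ‖1 - Complex.cos θ‖ = Real.cosh θ.im - Real.cos θ.re := by
  have h0 : 0 ≤ Real.cosh θ.im - Real.cos θ.re := by
    linarith [Real.one_le_cosh θ.im, Real.cos_le_one θ.re]
  rw [← sq_eq_sq₀ (norm_nonneg _) h0, ← Complex.normSq_eq_norm_sq, Complex.normSq_apply]
  have hre : (Complex.cos θ).re = Real.cos θ.re * Real.cosh θ.im := by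
    rw [Complex.cos_eq θ]; simp [← Complex.ofReal_cos, ← Complex.ofReal_cosh, ← Complex.ofReal_sin, ← Complex.ofReal_sinh]
  have him : (Complex.cos θ).im = - (Real.sin θ.re * Real.sinh θ.im) := by
    rw [Complex.cos_eq θ]; simp [← Complex.ofReal_cos, ← Complex.ofReal_cosh, ← Complex.ofReal_sin, ← Complex.ofReal_sinh]
  simp only [Complex.sub_re, Complex.one_re, Complex.sub_im, Complex.one_im, hre, him]
  have e1 := Real.sin_sq_add_cos_sq θ.re
  have e2 := Real.cosh_sq θ.im
  have e3 : Real.sin θ.re ^ 2 = 1 - Real.cos θ.re ^ 2 := by linarith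
  have e4 : Real.sinh θ.im ^ 2 = Real.cosh θ.im ^ 2 - 1 := by linarith
  have : (0 - -(Real.sin θ.re * Real.sinh θ.im)) * (0 - -(Real.sin θ.re * Real.sinh θ.im))
    = Real.sin θ.re ^ 2 * Real.sinh θ.im ^ 2 := by ring
  rw [this, e3, e4]
  ring

lemma cosh_im_eq (θ : ℂ) :
    Real.cosh θ.im = (‖1 - Complex.cos θ‖ + ‖1 + Complex.cos θ‖) / 2 := by
  have h2 := norm_one_sub_cos (θ + Real.pi)
  rw [Complex.cos_add_pi] at h2
  simp only [sub_neg_eq_add, Complex.add_im, Complex.ofReal_im, add_zero, Complex.add_re,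
    Complex.ofReal_re, Real.cos_add_pi] at h2
  rw [norm_one_sub_cos, h2]; ring

lemma one_add_sq_le_cosh (y : ℝ) : 1 + y ^ 2 / 2 ≤ Real.cosh y := by
  have h : Real.cosh y = 1 + 2 * Real.sinh (y / 2) ^ 2 := by
    have := Real.cosh_two_mul (y / 2)
    rw [show 2 * (y / 2) = y by ring, Real.cosh_sq] at this
    rw [this]; ring
  have h1 : |y / 2| ≤ |Real.sinh (y / 2)| := by
    rw [Real.abs_sinh]
    exact Real.self_le_sinh_iff.2 (abs_nonneg _)
  have h2 := sq_le_sq.2 h1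
  rw [h]; nlinarith

lemma cheb_bound (w : ℂ) (t δ η : ℝ) (ht : t ∈ Set.Icc (-1 : ℝ) 1) (hw : ‖w - t‖ ≤ δ) (hη : 0 ≤ η)
    (hδ : 2 * δ ≤ η ^ 2) (k : ℤ) : ‖(Polynomial.Chebyshev.T ℂ k).eval w‖ ≤ Real.exp (|(k : ℝ)| * η) := by
  obtain ⟨θ, rfl⟩ := Complex.cos_surjective w
  rw [Polynomial.Chebyshev.T_complex_cos]
  have hcosh : Real.cosh θ.im ≤ 1 + δ := by
    rw [cosh_im_eq]
    have h1 : ‖1 - Complex.cos θ‖ ≤ (1 - t) + δ := by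
      calc ‖1 - Complex.cos θ‖ = ‖((1 - t : ℝ) : ℂ) - (Complex.cos θ - t)‖ := by push_cast; ring_nf
        _ ≤ ‖((1 - t : ℝ) : ℂ)‖ + ‖Complex.cos θ - t‖ := norm_sub_le _ _
        _ ≤ _ := by
          rw [Complex.norm_real, Real.norm_of_nonneg (by linarith [ht.2])]; linarith
    have h2 : ‖1 + Complex.cos θ‖ ≤ (1 + t) + δ := by
      calc ‖1 + Complex.cos θ‖ = ‖((1 + t : ℝ) : ℂ) + (Complex.cos θ - t)‖ := by push_cast; ring_nf
        _ ≤ ‖((1 + t : ℝ) : ℂ)‖ + ‖Complex.cos θ - t‖ := norm_add_le _ _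
        _ ≤ _ := by
          rw [Complex.norm_real, Real.norm_of_nonneg (by linarith [ht.1])]; linarith
    linarith
  have him : |θ.im| ≤ η := by
    refine abs_le_of_sq_le_sq ?_ hη
    linarith [one_add_sq_le_cosh θ.im]
  have hk : ‖Complex.cos (k * θ)‖ ≤ Real.exp (|(k : ℝ)| * |θ.im|) := by
    rw [Complex.cos, norm_div, Complex.norm_two, div_le_iff₀ (by norm_num)]
    refine (norm_add_le _ _).trans ?_
    rw [Complex.norm_exp, Complex.norm_exp]
    have a1 : (k * θ * Complex.I).re ≤ |(k : ℝ)| * |θ.im| := by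
      rw [← abs_mul]
      have := neg_le_abs ((k : ℝ) * θ.im)
      simpa [-abs_mul] using this
    have a2 : (-(k * θ) * Complex.I).re ≤ |(k : ℝ)| * |θ.im| := by
      rw [← abs_mul]
      have := le_abs_self ((k : ℝ) * θ.im)
      simpa [-abs_mul] using this
    linarith [Real.exp_le_exp.2 a1, Real.exp_le_exp.2 a2]
  exact hk.trans (Real.exp_le_exp.2 (mul_le_mul_of_nonneg_left him (abs_nonneg _)))

lemma summable_exp_abs (η : ℝ) (hη : 0 < η) : Summable fun k : ℤ => Real.exp (-(|(k : ℝ)| * η)) := by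
  have h : Summable fun k : ℕ => Real.exp (-(k * η)) := by
    have := summable_geometric_of_lt_one (Real.exp_nonneg (-η)) (by rw [← Real.exp_zero]; exact Real.exp_lt_exp.2 (by linarith))
    refine this.congr fun k => ?_
    rw [← Real.exp_nat_mul]; ring_nf
  refine Summable.of_nat_of_neg ?_ ?_
  · simpa using h
  · simpa using h

/-- The 1-neighbourhood radius `ρ` of `[-a,a]`. -/
def nbhd (a ρ : ℝ) : Set ℂ := Metric.thickening ρ ((fun t : ℝ => (t : ℂ)) '' Set.Icc (-a) a)

lemma mem_nbhd {a ρ : ℝ} {z : ℂ} : z ∈ nbhd a ρ ↔ ∃ t ∈ Set.Icc (-a) a, ‖z - (t : ℂ)‖ < ρ := by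
  simp [nbhd, Metric.mem_thickening_iff, dist_eq_norm]

lemma isOpen_nbhd (a ρ : ℝ) : IsOpen (nbhd a ρ) := Metric.isOpen_thickening

lemma convex_nbhd (a ρ : ℝ) : Convex ℝ (nbhd a ρ) := by
  refine Convex.thickening ?_ ρ
  exact (convex_Icc (-a) a).linear_image Complex.ofRealCLM.toLinearMap

lemma neg_mem_nbhd {a ρ : ℝ} {z : ℂ} (hz : z ∈ nbhd a ρ) : -z ∈ nbhd a ρ := by
  rw [mem_nbhd] at hz ⊢
  obtain ⟨t, ht, h⟩ := hz
  refine ⟨-t, ⟨by linarith [ht.2], by linarith [ht.1]⟩, ?_⟩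
  rw [← norm_neg]; rw [show -(-z - ((-t : ℝ) : ℂ)) = z - t by push_cast; ring]; exact h

lemma hasSum_real (f : ℂ → ℂ) (hf : Differentiable ℂ f) (a : ℝ)
    (hsum : Summable (fourierCoeff (circFun f hf.continuous a))) (u : ℝ) (hu : u ∈ Set.Icc (-1 : ℝ) 1) :
    HasSum (fun k : ℤ => fourierCoeff (circFun f hf.continuous a) k *
      (Polynomial.Chebyshev.T ℂ k).eval (u : ℂ)) (f (a * u)) := by
  set c := fourierCoeff (circFun f hf.continuous a)
  obtain ⟨θ, rfl⟩ : ∃ θ : ℝ, Real.cos θ = u := ⟨Real.arccos u, Real.cos_arccos hu.1 hu.2⟩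
  have h1 := has_pointwise_sum_fourier_series_of_summable hsum (θ : AddCircle (2 * Real.pi))
  have h2 := has_pointwise_sum_fourier_series_of_summable hsum ((-θ : ℝ) : AddCircle (2 * Real.pi))
  rw [circFun_coe] at h1 h2
  have h3 := (h1.add h2).mul_left (1 / 2 : ℂ)
  have e1 : f (a * (Real.cos θ : ℝ)) =
      1 / 2 * (f (a * Complex.cos θ) + f (a * Complex.cos ((-θ : ℝ) : ℂ))) := by
    push_cast
    rw [Complex.cos_neg]; ring
  rw [e1]
  refine h3.congr_fun ?_
  intro k
  rw [fourier_two_pi, fourier_two_pi, Complex.ofReal_cos, Polynomial.Chebyshev.T_complex_cos,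
    Complex.cos]
  simp only [smul_eq_mul]
  push_cast
  rw [show (k : ℂ) * -(θ : ℂ) * Complex.I = -(k * θ) * Complex.I by ring]
  ring

lemma cheb_approx (f : ℂ → ℂ) (hf : Differentiable ℂ f) (κ K : ℝ) (hκ : 0 ≤ κ) (hK : 0 ≤ K)
    (hb : ∀ z, ‖f z‖ ≤ K * Real.exp (κ * |z.im|)) (a s η : ℝ) (ha : 0 < a) (hη : 0 < η)
    (hs : 2 * η ≤ s) (haη : 2 * (1 / a) ≤ η ^ 2) (N : ℕ) :
    ∃ Q : Polynomial ℂ, Q.natDegree ≤ N ∧ ∀ z ∈ nbhd a 1, ‖f z - Q.eval z‖ ≤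
      K * Real.exp (κ * a * Real.sinh s) * Real.exp (-((N + 1) * (s - 2 * η))) *
        ∑' k : ℤ, Real.exp (-(|(k : ℝ)| * η)) := by
  set c := fourierCoeff (circFun f hf.continuous a) with hc
  set A := K * Real.exp (κ * a * Real.sinh s) with hA
  have hA0 : 0 ≤ A := by positivity
  have hcb : ∀ k, ‖c k‖ ≤ A * Real.exp (-(|(k : ℝ)| * s)) :=
    coeff_bound f hf κ K hκ hK hb a s ha.le (by linarith)
  have hS := summable_exp_abs η hη
  have hterm : ∀ (k : ℤ) (z : ℂ), z ∈ nbhd a 1 →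
      ‖c k * (Polynomial.Chebyshev.T ℂ k).eval (z / a)‖ ≤
        A * (Real.exp (-(|(k : ℝ)| * (s - 2 * η))) * Real.exp (-(|(k : ℝ)| * η))) := by
    intro k z hz
    obtain ⟨t, ht, hzt⟩ := mem_nbhd.1 hz
    have hT := cheb_bound (z / a) (t / a) (1 / a) η
      ⟨by rw [le_div_iff₀ ha]; linarith [ht.1], by rw [div_le_iff₀ ha]; linarith [ht.2]⟩
      (by
        rw [Complex.ofReal_div, ← sub_div, norm_div, Complex.norm_real, Real.norm_of_nonneg ha.le]
        gcongr) hη.le haη k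
    rw [norm_mul]
    calc _ ≤ A * Real.exp (-(|(k : ℝ)| * s)) * Real.exp (|(k : ℝ)| * η) :=
          mul_le_mul (hcb k) hT (norm_nonneg _) (by positivity)
      _ = _ := by
          rw [mul_assoc, ← Real.exp_add, ← Real.exp_add]; ring_nf
  have hsη : 0 ≤ s - 2 * η := by linarith
  have hterm' : ∀ (k : ℤ) (z : ℂ), z ∈ nbhd a 1 →
      ‖c k * (Polynomial.Chebyshev.T ℂ k).eval (z / a)‖ ≤ A * Real.exp (-(|(k : ℝ)| * η)) := by
    intro k z hz
    refine (hterm k z hz).trans (mul_le_mul_of_nonneg_left ?_ hA0)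
    refine mul_le_of_le_one_left (Real.exp_nonneg _) (Real.exp_le_one_iff.2 ?_)
    have := mul_nonneg (abs_nonneg (k : ℝ)) hsη
    linarith
  have hcs : Summable c := by
    refine Summable.of_norm_bounded (hS.mul_left A) fun k => (hcb k).trans ?_
    refine mul_le_mul_of_nonneg_left (Real.exp_le_exp.2 ?_) hA0
    have := mul_le_mul_of_nonneg_left (show η ≤ s by linarith) (abs_nonneg (k : ℝ))
    linarith
  have hSd : DifferentiableOn ℂ
      (fun z : ℂ => ∑' k : ℤ, c k * (Polynomial.Chebyshev.T ℂ k).eval (z / a)) (nbhd a 1) := by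
    refine Complex.differentiableOn_tsum_of_summable_norm (hS.mul_left A) (fun k => ?_)
      (isOpen_nbhd a 1) hterm'
    have : Differentiable ℂ fun z : ℂ => c k * (Polynomial.Chebyshev.T ℂ k).eval (z / a) := by
      have h1 := (Polynomial.Chebyshev.T ℂ k).differentiable
      exact (h1.comp (differentiable_id.div_const _)).const_mul _
    exact this.differentiableOn
  have hreal : ∀ t ∈ Set.Icc (-a) a,
      (∑' k : ℤ, c k * (Polynomial.Chebyshev.T ℂ k).eval ((t : ℂ) / a)) = f t := by
    intro t ht
    have := (hasSum_real f hf a hcs (t / a)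
      ⟨by rw [le_div_iff₀ ha]; linarith [ht.1], by rw [div_le_iff₀ ha]; linarith [ht.2]⟩).tsum_eq
    have ha' : (a : ℂ) ≠ 0 := by exact_mod_cast ha.ne'
    rw [Complex.ofReal_div, mul_div_cancel₀ _ ha'] at this
    exact this
  have h0 : (0 : ℂ) ∈ nbhd a 1 := mem_nbhd.2 ⟨0, ⟨by linarith, ha.le⟩, by simp⟩
  have heq : Set.EqOn (fun z : ℂ => ∑' k : ℤ, c k * (Polynomial.Chebyshev.T ℂ k).eval (z / a)) f
      (nbhd a 1) := by
    refine AnalyticOnNhd.eqOn_of_preconnected_of_frequently_eq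
      (hSd.analyticOnNhd (isOpen_nbhd a 1)) (hf.differentiableOn.analyticOnNhd (isOpen_nbhd a 1))
      (convex_nbhd a 1).isPreconnected h0 ?_
    have hten : Tendsto (fun t : ℝ => (t : ℂ)) (𝓝[>] 0) (𝓝[≠] (0 : ℂ)) := by
      refine tendsto_nhdsWithin_iff.2 ⟨?_, ?_⟩
      · have : Tendsto (fun t : ℝ => (t : ℂ)) (𝓝 0) (𝓝 ((0 : ℝ) : ℂ)) :=
          Complex.continuous_ofReal.tendsto 0
        simpa using this.mono_left nhdsWithin_le_nhds
      · filter_upwards [self_mem_nhdsWithin] with t ht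
        simpa using (ne_of_gt ht)
    refine hten.frequently (Eventually.frequently ?_)
    filter_upwards [Ioo_mem_nhdsGT ha] with t ht
    exact hreal t ⟨by linarith [ht.1], ht.2.le⟩
  refine ⟨∑ k ∈ Finset.Icc (-(N : ℤ)) N, Polynomial.C (c k) *
    (Polynomial.Chebyshev.T ℂ k).comp (Polynomial.C ((a : ℂ)⁻¹) * Polynomial.X), ?_, ?_⟩
  · refine Polynomial.natDegree_sum_le_of_forall_le _ _ fun k hk => ?_
    refine (Polynomial.natDegree_C_mul_le _ _).trans (Polynomial.natDegree_comp_le.trans ?_)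
    rw [Polynomial.Chebyshev.natDegree_T]
    have h1 : (Polynomial.C ((a : ℂ)⁻¹) * Polynomial.X).natDegree ≤ 1 :=
      (Polynomial.natDegree_C_mul_le _ _).trans Polynomial.natDegree_X_le
    have h2 : k.natAbs ≤ N := by
      rw [Finset.mem_Icc] at hk; omega
    calc _ ≤ k.natAbs * 1 := Nat.mul_le_mul_left _ h1
      _ ≤ N := by simpa using h2
  · intro z hz
    have hsz : Summable fun k : ℤ => c k * (Polynomial.Chebyshev.T ℂ k).eval (z / a) :=
      Summable.of_norm_bounded (hS.mul_left A) fun k => hterm' k z hz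
    rw [← heq hz]
    have he : (∑ k ∈ Finset.Icc (-(N : ℤ)) N, Polynomial.C (c k) *
      (Polynomial.Chebyshev.T ℂ k).comp (Polynomial.C ((a : ℂ)⁻¹) * Polynomial.X)).eval z =
      ∑ k ∈ Finset.Icc (-(N : ℤ)) N, c k * (Polynomial.Chebyshev.T ℂ k).eval (z / a) := by
      rw [Polynomial.eval_finsetSum]
      refine Finset.sum_congr rfl fun k _ => ?_
      simp [Polynomial.eval_comp, div_eq_inv_mul]
    rw [he]
    set g : ℤ → ℂ := fun k => c k * (Polynomial.Chebyshev.T ℂ k).eval (z / a) with hg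
    have hsplit := hsz.sum_add_tsum_subtype_compl (Finset.Icc (-(N : ℤ)) N)
    have : (∑' k, g k) - ∑ k ∈ Finset.Icc (-(N : ℤ)) N, g k =
        ∑' k : {k // k ∉ Finset.Icc (-(N : ℤ)) N}, g k := by
      rw [← hsplit]; ring
    change ‖(∑' k, g k) - ∑ k ∈ Finset.Icc (-(N : ℤ)) N, g k‖ ≤ _
    rw [this, ← tsum_mul_left]
    have hS2 := hS.mul_left (A * Real.exp (-((N + 1) * (s - 2 * η))))
    refine (tsum_of_norm_bounded (hS2.subtype {k | k ∉ Finset.Icc (-(N : ℤ)) N}).hasSum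
      fun k => ?_).trans (hS2.tsum_subtype_le _ _ fun k => by positivity)
    refine (hterm k.1 z hz).trans ?_
    rw [← mul_assoc]
    refine mul_le_mul_of_nonneg_right (mul_le_mul_of_nonneg_left (Real.exp_le_exp.2 ?_) hA0)
      (Real.exp_nonneg _)
    have hk : (N : ℝ) + 1 ≤ |((k.1 : ℤ) : ℝ)| := by
      have h1 := k.2
      simp only [Finset.mem_Icc, not_and_or, not_le] at h1
      have : (N : ℤ) + 1 ≤ |k.1| := by
        rcases h1 with h | h
        · rw [abs_of_nonpos (by omega)]; omega
        · rw [abs_of_nonneg (by omega)]; omega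
      exact_mod_cast this
    have := mul_le_mul_of_nonneg_right hk hsη
    linarith

/-! ### Derivatives and the Bessel operator -/

lemma sphere_subset_nbhd {a ρ : ℝ} {z w : ℂ} (hz : z ∈ nbhd a (ρ / 2))
    (hw : w ∈ Metric.sphere z (ρ / 2)) : w ∈ nbhd a ρ := by
  obtain ⟨t, ht, h⟩ := mem_nbhd.1 hz
  refine mem_nbhd.2 ⟨t, ht, ?_⟩
  have h2 : ‖w - z‖ = ρ / 2 := by simpa [dist_eq_norm] using hw
  calc ‖w - t‖ = ‖(w - z) + (z - t)‖ := by ring_nf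
    _ ≤ _ := norm_add_le _ _
    _ < ρ := by linarith

lemma real_mem_nbhd {a ρ t : ℝ} (hρ : 0 < ρ) (ht : t ∈ Set.Icc (-a) a) : (t : ℂ) ∈ nbhd a ρ :=
  mem_nbhd.2 ⟨t, ht, by simpa using hρ⟩

lemma iteratedDeriv_bound (E : ℂ → ℂ) (hE : Differentiable ℂ E) (a ρ ε : ℝ) (hρ : 0 < ρ)
    (hb : ∀ z ∈ nbhd a ρ, ‖E z‖ ≤ ε) (l : ℕ) (z : ℂ) (hz : z ∈ nbhd a (ρ / 2)) :
    ‖iteratedDeriv l E z‖ ≤ l.factorial / (ρ / 2) ^ l * ε := by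
  have := Complex.norm_iteratedDeriv_le_of_forall_mem_sphere_norm_le (f := E) l (half_pos hρ)
    hE.diffContOnCl (fun w hw => hb w (sphere_subset_nbhd hz hw))
  refine this.trans (le_of_eq (by ring))

lemma deriv_even (f : ℂ → ℂ) (hfe : ∀ z, f (-z) = f z) (z : ℂ) : deriv f (-z) = - deriv f z := by
  have h : (fun z => f (-z)) = f := funext hfe
  have := deriv_comp_neg f z
  rw [h] at this
  rw [this, neg_neg]

lemma deriv_odd (f : ℂ → ℂ) (hfe : ∀ z, f (-z) = - f z) (z : ℂ) : deriv f (-z) = deriv f z := by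
  have h : (fun z => f (-z)) = fun z => - f z := funext hfe
  have h2 := deriv_comp_neg f z
  have h3 : deriv (fun z => - f z) z = - deriv f z := deriv.fun_neg
  rw [h, h3] at h2
  exact (neg_injective h2).symm

lemma deriv_even_zero (f : ℂ → ℂ) (hfe : ∀ z, f (-z) = f z) : deriv f 0 = 0 := by
  have := deriv_even f hfe 0
  rw [neg_zero] at this
  exact self_eq_neg.1 this

lemma besselOp_even (ν : ℝ) (f : ℂ → ℂ) (hfe : ∀ z, f (-z) = f z) (z : ℂ) :
    besselOp ν f (-z) = besselOp ν f z := by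
  by_cases hz : z = 0
  · simp [hz]
  · simp only [besselOp, neg_eq_zero, hz, if_false]
    rw [deriv_even f hfe, deriv_odd _ (deriv_even f hfe), neg_div_neg_eq]

lemma differentiable_deriv {f : ℂ → ℂ} (hf : Differentiable ℂ f) : Differentiable ℂ (deriv f) := by
  have := (hf.differentiableOn (s := Set.univ)).deriv isOpen_univ
  exact differentiableOn_univ.1 this

lemma besselOp_eq (ν : ℝ) (f : ℂ → ℂ) (hfe : ∀ z, f (-z) = f z) :
    besselOp ν f = fun z => deriv (deriv f) z + (2 * ν + 1) * dslope (deriv f) 0 z := by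
  ext z
  by_cases hz : z = 0
  · subst hz
    simp only [besselOp, if_true, dslope_same]; ring
  · simp only [besselOp, hz, if_false, dslope_of_ne _ hz, slope_def_field, deriv_even_zero f hfe,
      sub_zero]

lemma besselOp_differentiable (ν : ℝ) (f : ℂ → ℂ) (hf : Differentiable ℂ f)
    (hfe : ∀ z, f (-z) = f z) : Differentiable ℂ (besselOp ν f) := by
  rw [besselOp_eq ν f hfe]
  have h1 := differentiable_deriv hf
  have h2 := differentiable_deriv h1
  have h3 : Differentiable ℂ (dslope (deriv f) 0) := by
    rw [← differentiableOn_univ]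
    exact (Complex.differentiableOn_dslope univ_mem).2 h1.differentiableOn
  exact h2.add (h3.const_mul _)

lemma besselOp_sub (ν : ℝ) (f g : ℂ → ℂ) (hf : Differentiable ℂ f) (hg : Differentiable ℂ g) :
    besselOp ν (fun z => f z - g z) = fun z => besselOp ν f z - besselOp ν g z := by
  have h1 : deriv (fun z => f z - g z) = fun z => deriv f z - deriv g z :=
    funext fun z => deriv_fun_sub (hf z) (hg z)
  have h2 : deriv (fun z => deriv f z - deriv g z) = fun z => deriv (deriv f) z - deriv (deriv g) z :=
    funext fun z => deriv_fun_sub (differentiable_deriv hf z) (differentiable_deriv hg z)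
  ext z
  simp only [besselOp, h1, h2]
  split_ifs <;> ring

lemma besselOp_iter_sub (ν : ℝ) (l : ℕ) : ∀ (f g : ℂ → ℂ), Differentiable ℂ f → Differentiable ℂ g →
    (∀ z, f (-z) = f z) → (∀ z, g (-z) = g z) →
    (besselOp ν)^[l] (fun z => f z - g z) = fun z => (besselOp ν)^[l] f z - (besselOp ν)^[l] g z := by
  induction l with
  | zero => intro f g _ _ _ _; rfl
  | succ l ih =>
    intro f g hf hg hfe hge
    simp only [Function.iterate_succ, Function.comp]
    rw [besselOp_sub ν f g hf hg]
    exact ih _ _ (besselOp_differentiable ν f hf hfe) (besselOp_differentiable ν g hg hge)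
      (besselOp_even ν f hfe) (besselOp_even ν g hge)

lemma besselOp_bound (ν : ℝ) (E : ℂ → ℂ) (hE : Differentiable ℂ E) (hEe : ∀ z, E (-z) = E z)
    (a ρ ε : ℝ) (ha : 0 ≤ a) (hρ : 0 < ρ)
    (hb : ∀ z ∈ nbhd a ρ, ‖E z‖ ≤ ε) (z : ℂ) (hz : z ∈ nbhd a (ρ / 2)) :
    ‖besselOp ν E z‖ ≤ (1 + |2 * ν + 1|) * (2 / (ρ / 2) ^ 2) * ε := by
  have h2 : ∀ z ∈ nbhd a (ρ / 2), ‖deriv (deriv E) z‖ ≤ 2 / (ρ / 2) ^ 2 * ε := by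
    intro z hz
    have := iteratedDeriv_bound E hE a ρ ε hρ hb 2 z hz
    simpa [iteratedDeriv_succ, iteratedDeriv_zero] using this
  have h0 : (0 : ℂ) ∈ nbhd a (ρ / 2) := by
    simpa using real_mem_nbhd (half_pos hρ) (show (0 : ℝ) ∈ Set.Icc (-a) a from ⟨by linarith, ha⟩)
  have hn : ‖(2 * ν + 1 : ℂ)‖ = |2 * ν + 1| := by
    rw [← Real.norm_eq_abs, ← Complex.norm_real]; push_cast; rfl
  rw [mul_assoc]
  by_cases hz0 : z = 0
  · subst hz0
    simp only [besselOp, if_true]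
    rw [norm_mul]
    refine mul_le_mul ?_ (h2 0 h0) (norm_nonneg _) (by positivity)
    calc ‖(2 * ν + 2 : ℂ)‖ = ‖(1 : ℂ) + (2 * ν + 1)‖ := by ring_nf
      _ ≤ ‖(1 : ℂ)‖ + ‖(2 * ν + 1 : ℂ)‖ := norm_add_le _ _
      _ = _ := by rw [hn]; simp
  · simp only [besselOp, hz0, if_false]
    have h3 : ‖deriv E z / z‖ ≤ 2 / (ρ / 2) ^ 2 * ε := by
      have := (convex_nbhd a (ρ / 2)).norm_image_sub_le_of_norm_deriv_le
        (fun x _ => differentiable_deriv hE x) h2 h0 hz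
      rw [deriv_even_zero E hEe, sub_zero, sub_zero] at this
      rw [norm_div, div_le_iff₀ (norm_pos_iff.2 hz0)]
      exact this
    refine (norm_add_le _ _).trans ?_
    rw [norm_mul, hn, add_mul, one_mul]
    exact add_le_add (h2 z hz) (mul_le_mul_of_nonneg_left h3 (abs_nonneg _))

lemma besselOp_iter_bound (ν : ℝ) (l : ℕ) : ∀ ρ : ℝ, 0 < ρ → ∃ C : ℝ, 0 ≤ C ∧
    ∀ (E : ℂ → ℂ), Differentiable ℂ E → (∀ z, E (-z) = E z) → ∀ a ε : ℝ, 0 ≤ a →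
      (∀ z ∈ nbhd a ρ, ‖E z‖ ≤ ε) → ∀ t ∈ Set.Icc (-a) a, ‖(besselOp ν)^[l] E t‖ ≤ C * ε := by
  induction l with
  | zero =>
    intro ρ hρ
    refine ⟨1, zero_le_one, fun E _ _ a ε _ hb t ht => ?_⟩
    simpa using hb t (real_mem_nbhd hρ ht)
  | succ l ih =>
    intro ρ hρ
    obtain ⟨C, hC, h⟩ := ih (ρ / 2) (half_pos hρ)
    refine ⟨C * ((1 + |2 * ν + 1|) * (2 / (ρ / 2) ^ 2)), by positivity,
      fun E hE hEe a ε ha hb t ht => ?_⟩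
    have := h (besselOp ν E) (besselOp_differentiable ν E hE hEe) (besselOp_even ν E hEe) a _ ha
      (besselOp_bound ν E hE hEe a ρ ε ha hρ hb) t ht
    rw [Function.iterate_succ_apply, mul_assoc]
    exact this

/-! ### The weighted measure -/

lemma integrable_weight (α β : ℝ) (hα : -1 < α) (hβ : -1 < β) :
    IntervalIntegrable (fun u : ℝ => |u| ^ α * (1 - u ^ 2) ^ β) volume (-1) 1 := by
  have h1 : IntervalIntegrable (fun u : ℝ => |u| ^ α * (1 - u ^ 2) ^ β) volume 0 1 := by
    have hb := Complex.betaIntegral_convergent (u := ((α + 1 : ℝ) : ℂ)) (v := ((β + 1 : ℝ) : ℂ))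
      (by simpa using by linarith) (by simpa using by linarith)
    have hc : ContinuousOn (fun x : ℝ => (1 + x) ^ β) (Set.uIcc 0 1) := by
      rw [Set.uIcc_of_le zero_le_one]
      refine ContinuousOn.rpow_const (by fun_prop) fun x hx => Or.inl ?_
      have := hx.1
      positivity
    have h := hb.norm.mul_continuousOn hc
    refine h.congr ?_
    intro x hx
    rw [Set.uIoc_of_le zero_le_one] at hx
    have hx0 : 0 ≤ x := hx.1.le
    have hx1 : 0 ≤ 1 - x := by linarith [hx.2]
    have e1 : (x : ℂ) ^ (((α + 1 : ℝ) : ℂ) - 1) = ((x ^ α : ℝ) : ℂ) := by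
      rw [Complex.ofReal_cpow hx0]; push_cast; ring_nf
    have e2 : (1 - (x : ℂ)) ^ (((β + 1 : ℝ) : ℂ) - 1) = (((1 - x) ^ β : ℝ) : ℂ) := by
      rw [Complex.ofReal_cpow hx1]; push_cast; ring_nf
    simp only [e1, e2]
    rw [← Complex.ofReal_mul, Complex.norm_real, Real.norm_of_nonneg (by positivity), mul_assoc,
      ← Real.mul_rpow hx1 (by linarith), abs_of_nonneg hx0]
    ring_nf
  have h2 : IntervalIntegrable (fun u : ℝ => |u| ^ α * (1 - u ^ 2) ^ β) volume (-1) 0 := by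
    have := (IntervalIntegrable.iff_comp_neg).1 h1
    simpa using this.symm
  exact h2.trans h1

lemma wMeasN_bound (τ α β : ℝ) (hτ : 0 < τ) (hα : -1 < α) (hβ : -1 < β) :
    ∃ B : ℝ≥0∞, B ≠ ∞ ∧ ∀ n : ℕ, 1 ≤ n →
      wMeasN τ α β n Set.univ ≤ B * ENNReal.ofReal ((τ * n) ^ (α + 1)) := by
  refine ⟨∫⁻ u in Set.Icc (-1 : ℝ) 1, ENNReal.ofReal (|u| ^ α * (1 - u ^ 2) ^ β), ?_, ?_⟩
  · have h := integrable_weight α β hα hβ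
    rw [intervalIntegrable_iff_integrableOn_Icc_of_le (by norm_num)] at h
    exact (lt_of_le_of_lt (lintegral_mono fun u => ENNReal.ofReal_le_ofReal (le_abs_self _))
      ((hasFiniteIntegral_iff_norm _).1 h.hasFiniteIntegral)).ne
  · intro n hn
    have hn' : (0 : ℝ) < n := by exact_mod_cast hn
    set a := τ * n with ha
    have ha0 : 0 < a := by positivity
    rw [wMeasN, withDensity_apply _ MeasurableSet.univ, Measure.restrict_univ, ← ha]
    set W : ℝ → ℝ≥0∞ := fun t => ENNReal.ofReal (|t| ^ α * (1 - (t / a) ^ 2) ^ β) with hW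
    have hWm : Measurable W := by
      apply Measurable.ennreal_ofReal
      fun_prop
    rw [← lintegral_indicator measurableSet_Icc, ← lintegral_indicator measurableSet_Icc]
    have hmap := Real.map_volume_mul_left ha0.ne'
    have h1 : ∫⁻ u, (Set.Icc (-a) a).indicator W (a * u) =
        ENNReal.ofReal a⁻¹ * ∫⁻ t, (Set.Icc (-a) a).indicator W t := by
      rw [← lintegral_map (f := (Set.Icc (-a) a).indicator W) (hWm.indicator measurableSet_Icc)
        (measurable_const_mul a), hmap, lintegral_smul_measure, abs_of_pos (inv_pos.2 ha0)]
      rfl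
    have h2 : ∀ u, (Set.Icc (-a) a).indicator W (a * u) = ENNReal.ofReal (a ^ α) *
        (Set.Icc (-1 : ℝ) 1).indicator
          (fun u => ENNReal.ofReal (|u| ^ α * (1 - u ^ 2) ^ β)) u := by
      intro u
      have hiff : a * u ∈ Set.Icc (-a) a ↔ u ∈ Set.Icc (-1 : ℝ) 1 := by
        simp only [Set.mem_Icc]
        constructor
        · rintro ⟨h, h'⟩; constructor <;> nlinarith
        · rintro ⟨h, h'⟩; constructor <;> nlinarith
      by_cases hu : u ∈ Set.Icc (-1 : ℝ) 1
      · rw [Set.indicator_of_mem (hiff.2 hu), Set.indicator_of_mem hu, hW,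
          ← ENNReal.ofReal_mul (by positivity)]
        simp only
        rw [abs_mul, abs_of_pos ha0, Real.mul_rpow ha0.le (abs_nonneg _),
          mul_div_cancel_left₀ _ ha0.ne', mul_assoc]
      · rw [Set.indicator_of_notMem (fun h => hu (hiff.1 h)), Set.indicator_of_notMem hu, mul_zero]
    simp_rw [h2] at h1
    rw [lintegral_const_mul' _ _ ENNReal.ofReal_ne_top] at h1
    have h3 : ENNReal.ofReal (a ^ (α + 1)) = ENNReal.ofReal a * ENNReal.ofReal (a ^ α) := by
      rw [← ENNReal.ofReal_mul ha0.le, Real.rpow_add ha0, Real.rpow_one, mul_comm]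
    rw [mul_comm, h3, mul_assoc, h1, ← mul_assoc, ← ENNReal.ofReal_mul ha0.le,
      mul_inv_cancel₀ ha0.ne', ENNReal.ofReal_one, one_mul]

lemma final_tendsto (τ α β : ℝ) (hτ : τ ∈ Set.Ioo (0 : ℝ) 1) (hα : -1 < α) (hβ : -1 < β) (r : ℝ≥0∞)
    (g : ℕ → ℝ → ℂ) (K q : ℝ) (hK : 0 ≤ K) (hq0 : 0 ≤ q) (hq1 : q < 1)
    (hg : ∀ᶠ n : ℕ in atTop, ∀ t ∈ Set.Icc (-(τ * n)) (τ * n), ‖g n t‖ ≤ K * q ^ n) :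
    Tendsto (fun n : ℕ => eLpNorm (g n) r (wMeasN τ α β n)) atTop (𝓝 0) := by
  obtain ⟨B, hB, hBn⟩ := wMeasN_bound τ α β hτ.1 hα hβ
  set p := r.toReal⁻¹ with hp
  have hp0 : 0 ≤ p := inv_nonneg.2 ENNReal.toReal_nonneg
  set m := ⌈(α + 1) * p⌉₊ with hm
  have hreal : Tendsto (fun n : ℕ => K * ((n : ℝ) ^ m * q ^ n)) atTop (𝓝 0) := by
    have := (tendsto_pow_const_mul_const_pow_of_abs_lt_one m
      (show |q| < 1 by rwa [abs_of_nonneg hq0])).const_mul K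
    simpa using this
  have hlim : Tendsto (fun n : ℕ => B ^ p * ENNReal.ofReal (K * ((n : ℝ) ^ m * q ^ n))) atTop (𝓝 0) := by
    have h1 := ENNReal.tendsto_ofReal hreal
    have := ENNReal.Tendsto.const_mul h1 (Or.inr (ENNReal.rpow_ne_top_of_nonneg hp0 hB))
    simpa using this
  refine tendsto_of_tendsto_of_tendsto_of_le_of_le' tendsto_const_nhds hlim
    (Eventually.of_forall fun n => zero_le) ?_
  filter_upwards [hg, eventually_ge_atTop 1] with n hn hn1
  have hn' : (1 : ℝ) ≤ n := by exact_mod_cast hn1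
  have hae : ∀ᵐ t ∂(wMeasN τ α β n), ‖g n t‖ ≤ K * q ^ n := by
    refine (withDensity_absolutelyContinuous _ _).ae_le ?_
    filter_upwards [ae_restrict_mem measurableSet_Icc] with t ht using hn t ht
  refine (eLpNorm_le_of_ae_bound hae).trans ?_
  have hτn : 0 ≤ τ * n := mul_nonneg hτ.1.le (by linarith)
  calc wMeasN τ α β n Set.univ ^ p * ENNReal.ofReal (K * q ^ n)
      ≤ (B * ENNReal.ofReal ((τ * n) ^ (α + 1))) ^ p * ENNReal.ofReal (K * q ^ n) := by
        gcongr
        exact hBn n hn1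
    _ = B ^ p * (ENNReal.ofReal ((τ * n) ^ ((α + 1) * p)) * ENNReal.ofReal (K * q ^ n)) := by
        rw [ENNReal.mul_rpow_of_nonneg _ _ hp0, ENNReal.ofReal_rpow_of_nonneg (by positivity) hp0,
          ← Real.rpow_mul hτn, mul_assoc]
    _ ≤ B ^ p * ENNReal.ofReal (K * ((n : ℝ) ^ m * q ^ n)) := by
        rw [← ENNReal.ofReal_mul (by positivity)]
        refine mul_le_mul_right (ENNReal.ofReal_le_ofReal ?_) _
        have h1 : (τ * n) ^ ((α + 1) * p) ≤ (n : ℝ) ^ m := by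
          calc (τ * n) ^ ((α + 1) * p) ≤ (n : ℝ) ^ ((α + 1) * p) := by
                refine Real.rpow_le_rpow hτn ?_ (mul_nonneg (by linarith) hp0)
                nlinarith [hτ.2]
            _ ≤ (n : ℝ) ^ (m : ℝ) := Real.rpow_le_rpow_of_exponent_le hn' (Nat.le_ceil _)
            _ = (n : ℝ) ^ m := Real.rpow_natCast _ _
        calc _ ≤ (n : ℝ) ^ m * (K * q ^ n) := by gcongr
          _ = _ := by ring

/-! ### Assembling -/

lemma exists_s (c : ℝ) (hc : c < 1) : ∃ s : ℝ, 0 < s ∧ c * Real.sinh s < s := by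
  have h : HasDerivAt (fun s => s - c * Real.sinh s) (1 - c * Real.cosh 0) 0 :=
    (hasDerivAt_id 0).sub ((Real.hasDerivAt_sinh 0).const_mul c)
  rw [Real.cosh_zero, mul_one, hasDerivAt_iff_tendsto_slope] at h
  have h1 : ∀ᶠ s in 𝓝[>] (0 : ℝ), 0 < slope (fun s => s - c * Real.sinh s) 0 s :=
    (h.mono_left (nhdsWithin_mono _ fun x hx => ne_of_gt hx)).eventually_const_lt (by linarith)
  obtain ⟨s, hs, hs0⟩ := (h1.and self_mem_nhdsWithin).exists
  refine ⟨s, hs0, ?_⟩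
  have hs0' : (0 : ℝ) < s := hs0
  simp only [slope_def_field, Real.sinh_zero, mul_zero, sub_zero] at hs
  have := (div_pos_iff_of_pos_right hs0').1 hs
  linarith

lemma main_approx {τ : ℝ} (hτ : τ ∈ Set.Ioo (0 : ℝ) 1)
    (f : ℂ → ℂ) (hf : SphericalType1 1 f) (hfe : ∀ z : ℂ, f (-z) = f z)
    (hbd : BddAbove (Set.range fun t : ℝ => ‖f t‖)) :
    ∃ (P : ℕ → Polynomial ℂ) (K q : ℝ), 0 ≤ K ∧ 0 ≤ q ∧ q < 1 ∧
      (∀ n : ℕ, (P n).natDegree ≤ 2 * (n / 2) ∧ ∀ z : ℂ, (P n).eval (-z) = (P n).eval z) ∧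
      ∀ᶠ n : ℕ in atTop, ∀ z ∈ nbhd (τ * n) 1, ‖f z - (P n).eval z‖ ≤ K * q ^ n := by
  obtain ⟨hτ0, hτ1⟩ := hτ
  have hinv : 1 < τ⁻¹ := (one_lt_inv₀ hτ0).2 hτ1
  set δ := (τ⁻¹ - 1) / 2 with hδ
  have hδ0 : 0 < δ := by rw [hδ]; linarith
  obtain ⟨K, hK, hb⟩ := growth_im f hf hfe hbd δ hδ0
  have hlam : (1 + δ) * τ < 1 := by
    have : τ⁻¹ * τ = 1 := inv_mul_cancel₀ hτ0.ne'
    rw [hδ]; nlinarith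
  obtain ⟨s, hs0, hs⟩ := exists_s _ hlam
  set η := (s - (1 + δ) * τ * Real.sinh s) / 4 with hη
  have hη0 : 0 < η := by rw [hη]; linarith
  have hsh : 0 ≤ (1 + δ) * τ * Real.sinh s := by
    have := Real.sinh_nonneg_iff.2 hs0.le
    positivity
  have hηs : 2 * η ≤ s := by rw [hη]; linarith
  set S := ∑' k : ℤ, Real.exp (-(|(k : ℝ)| * η)) with hS
  have hS0 : 0 ≤ S := tsum_nonneg fun k => Real.exp_nonneg _
  have hex : ∀ n : ℕ, ∃ P : Polynomial ℂ, P.natDegree ≤ 2 * (n / 2) ∧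
      (∀ z : ℂ, P.eval (-z) = P.eval z) ∧ (0 < τ * n → 2 * (1 / (τ * n)) ≤ η ^ 2 →
        ∀ z ∈ nbhd (τ * n) 1, ‖f z - P.eval z‖ ≤ K * S * Real.exp (-(2 * η)) ^ n) := by
    intro n
    by_cases hn : 0 < τ * n ∧ 2 * (1 / (τ * n)) ≤ η ^ 2
    · obtain ⟨Q, hQd, hQ⟩ := cheb_approx f hf.1 (1 + δ) K (by linarith) hK hb (τ * n) s η hn.1 hη0
        hηs hn.2 (2 * (n / 2))
      have hQ' : ∀ z ∈ nbhd (τ * n) 1, ‖f z - Q.eval z‖ ≤ K * S * Real.exp (-(2 * η)) ^ n := by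
        intro z hz
        refine (hQ z hz).trans ?_
        rw [← Real.exp_nat_mul, mul_assoc K, ← Real.exp_add, mul_assoc, mul_comm _ S, ← mul_assoc]
        refine mul_le_mul_of_nonneg_left (Real.exp_le_exp.2 ?_) (by positivity)
        have hN : (n : ℝ) ≤ ((2 * (n / 2) : ℕ) : ℝ) + 1 := by
          have : n ≤ 2 * (n / 2) + 1 := by omega
          exact_mod_cast this
        have h1 := mul_le_mul_of_nonneg_right hN (show 0 ≤ s - 2 * η by linarith)
        have h2 : (1 + δ) * (τ * n) * Real.sinh s = n * (s - 4 * η) := by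
          rw [hη]; ring
        rw [h2]
        linarith
      refine ⟨Polynomial.C (1 / 2) * (Q + Q.comp (-Polynomial.X)), ?_, ?_, fun _ _ z hz => ?_⟩
      · refine (Polynomial.natDegree_C_mul_le _ _).trans
          ((Polynomial.natDegree_add_le _ _).trans (max_le hQd (Polynomial.natDegree_comp_le.trans ?_)))
        rw [Polynomial.natDegree_neg, Polynomial.natDegree_X, mul_one]
        exact hQd
      · intro z
        simp only [Polynomial.eval_mul, Polynomial.eval_add, Polynomial.eval_comp,
          Polynomial.eval_neg, Polynomial.eval_X, Polynomial.eval_C, neg_neg]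
        ring
      · have h1 := hQ' z hz
        have h2 := hQ' (-z) (neg_mem_nbhd hz)
        rw [hfe] at h2
        have e : f z - (Polynomial.C (1 / 2) * (Q + Q.comp (-Polynomial.X))).eval z =
            (1 / 2 : ℂ) * ((f z - Q.eval z) + (f z - Q.eval (-z))) := by
          simp only [Polynomial.eval_mul, Polynomial.eval_add, Polynomial.eval_comp,
            Polynomial.eval_neg, Polynomial.eval_X, Polynomial.eval_C]
          ring
        rw [e, norm_mul]
        have h3 := norm_add_le (f z - Q.eval z) (f z - Q.eval (-z))
        have h4 : ‖(1 / 2 : ℂ)‖ = 1 / 2 := by simp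
        rw [h4]
        linarith
    · exact ⟨0, by simp, by simp, fun h1 h2 => absurd ⟨h1, h2⟩ hn⟩
  choose P hP using hex
  refine ⟨P, K * S, Real.exp (-(2 * η)), by positivity, Real.exp_nonneg _, ?_,
    fun n => ⟨(hP n).1, (hP n).2.1⟩, ?_⟩
  · rw [← Real.exp_zero]; exact Real.exp_lt_exp.2 (by linarith)
  · have hlim : Tendsto (fun n : ℕ => 2 * (1 / (τ * (n : ℝ)))) atTop (𝓝 0) := by
      have := ((tendsto_natCast_atTop_atTop (R := ℝ)).const_mul_atTop hτ0).inv_tendsto_atTop.const_mul 2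
      simpa using this
    filter_upwards [eventually_gt_atTop 0, hlim.eventually_le_const (show 0 < η ^ 2 by positivity)]
      with n hn h
    exact (hP n).2.2 (mul_pos hτ0 (by exact_mod_cast hn)) h

lemma iterate_derivative_eval (P : Polynomial ℂ) (l : ℕ) (z : ℂ) :
    (derivative^[l] P).eval z = iteratedDeriv l (fun z => P.eval z) z := by
  induction l generalizing P with
  | zero => simp
  | succ l ih =>
    rw [Function.iterate_succ_apply, ih, iteratedDeriv_succ']
    congr 1
    ext w
    simp

/-- **Lemma 5.2.**  For `τ ∈ (0,1)`, `ν ≥ -1/2` and `f ∈ E_{1,1,e} ∩ L_∞(ℝ)` there are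
even polynomials `P_n` of degree at most `2⌊n/2⌋` such that for all `l ≥ 0`,
`r ∈ (0,∞]`, `α > -1` and `β > -1`, both
`‖f^{(l)} - P_n^{(l)}‖` and `‖(Be_ν)^l f - (Be_ν)^l P_n‖` in
`L_{r, |t|^α (1-(t/(τn))²)^β}([-τn, τn])` tend to `0` as `n → ∞`. -/
theorem polynomial_approximation_weighted
    {τ : ℝ} (hτ : τ ∈ Set.Ioo (0 : ℝ) 1) {ν : ℝ} (hν : -(1/2 : ℝ) ≤ ν)
    (f : ℂ → ℂ) (hf : SphericalType1 1 f) (hfe : ∀ z : ℂ, f (-z) = f z)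
    (hbd : BddAbove (Set.range fun t : ℝ => ‖f t‖)) :
    ∃ P : ℕ → Polynomial ℂ,
      (∀ n : ℕ, (P n).natDegree ≤ 2 * (n / 2) ∧
        ∀ z : ℂ, (P n).eval (-z) = (P n).eval z) ∧
      ∀ (l : ℕ) (r : ℝ≥0∞), 0 < r → ∀ α β : ℝ, -1 < α → -1 < β →
        Tendsto
          (fun n : ℕ =>
            eLpNorm
              (fun t : ℝ =>
                iteratedDeriv l f (t : ℂ) - (derivative^[l] (P n)).eval (t : ℂ))
              r (wMeasN τ α β n))
          atTop (𝓝 0) ∧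
        Tendsto
          (fun n : ℕ =>
            eLpNorm
              (fun t : ℝ =>
                (besselOp ν)^[l] f (t : ℂ) -
                  (besselOp ν)^[l] (fun z => (P n).eval z) (t : ℂ))
              r (wMeasN τ α β n))
          atTop (𝓝 0) := by
  obtain ⟨P, K, q, hK, hq0, hq1, hP, hE⟩ := main_approx hτ f hf hfe hbd
  refine ⟨P, hP, fun l r _ α β hα hβ => ⟨?_, ?_⟩⟩
  · refine final_tendsto τ α β hτ hα hβ r _ (l.factorial / (1 / 2) ^ l * K) q (by positivity)
      hq0 hq1 ?_
    filter_upwards [hE] with n hn t ht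
    have hd : Differentiable ℂ fun z => f z - (P n).eval z := hf.1.sub (P n).differentiable
    have := iteratedDeriv_bound _ hd (τ * n) 1 _ one_pos hn l t
      (real_mem_nbhd (by norm_num) ht)
    rw [mul_assoc, iterate_derivative_eval]
    have hsub : iteratedDeriv l (fun z => f z - (P n).eval z) (t : ℂ) =
        iteratedDeriv l f t - iteratedDeriv l (fun z => (P n).eval z) t :=
      iteratedDeriv_fun_sub (hf.1.contDiff.contDiffAt) ((P n).differentiable.contDiff.contDiffAt)
    rw [← hsub]
    exact this
  · obtain ⟨C, hC, hCb⟩ := besselOp_iter_bound ν l 1 one_pos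
    refine final_tendsto τ α β hτ hα hβ r _ (C * K) q (by positivity) hq0 hq1 ?_
    filter_upwards [hE] with n hn t ht
    have hd : Differentiable ℂ fun z => f z - (P n).eval z := hf.1.sub (P n).differentiable
    have := hCb _ hd (fun z => by rw [hfe, (hP n).2 z]) (τ * n) _
      (mul_nonneg hτ.1.le (Nat.cast_nonneg n)) hn t ht
    rw [besselOp_iter_sub ν l f _ hf.1 (P n).differentiable hfe (hP n).2] at this
    rw [mul_assoc]
    exact this
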